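/- Let F be a field of characteristic p > 0 and let n be a positive integer with n < p. Then every invertible n×n matrix A with entries in F admits a multiplicative Jordan decomposition defined over F: there exist n×n matrices s and u over F such that A = s·u = u·s, u − 1 is nilpotent (u is unipotent), and the image of s in M_n(F̄) is diagonalizable (semisimple), where F̄ is an algebraic closure of F. -/

import Mathlib

open Polynomial in
theorem Irreducible.separable_of_natDegree_lt_char {F : Type*} [Field F] (p : ℕ) [CharP F p]
    {f : F[X]} (hf : Irreducible f) (hdeg : f.natDegree < p) : f.Separable := by
  rw [separable_iff_derivative_ne_zero hf]
  intro h
  have hpos : 0 < f.natDegree := hf.natDegree_pos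
  have hc : f.leadingCoeff * (f.natDegree : F) = 0 := by
    have hcoeff := congr_arg (fun g : F[X] => g.coeff (f.natDegree - 1)) h
    simp only [coeff_derivative, coeff_zero] at hcoeff
    rwa [← Nat.cast_add_one, Nat.sub_add_cancel hpos] at hcoeff
  have hn := (mul_eq_zero.mp hc).resolve_left (leadingCoeff_ne_zero.mpr hf.ne_zero)
  rw [CharP.cast_eq_zero_iff F p] at hn
  exact hdeg.not_ge (Nat.le_of_dvd hpos hn)

open Polynomial in
theorem Squarefree.separable_of_natDegree_lt_char {F : Type*} [Field F] (p : ℕ) [CharP F p]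
    {f : F[X]} (sqf : Squarefree f) (hdeg : f.natDegree < p) : f.Separable := by
  refine isCoprime_of_irreducible_dvd (sqf.ne_zero ·.1) ?_
  rintro g hg hgf dvd
  have hsep := hg.separable_of_natDegree_lt_char p
    ((natDegree_le_of_dvd hgf sqf.ne_zero).trans_lt hdeg)
  obtain ⟨q, rfl⟩ := hgf
  rw [derivative_mul, dvd_add_left (dvd_mul_right g _)] at dvd
  exact hg.not_isUnit (sqf _ (mul_dvd_mul_left _ (hsep.dvd_of_dvd_mul_left dvd)))

theorem Matrix.natDegree_minpoly_le {F ι : Type*} [Field F] [Fintype ι] [DecidableEq ι]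
    (M : Matrix ι ι F) : (minpoly F M).natDegree ≤ Fintype.card ι :=
  (Polynomial.natDegree_le_of_dvd M.minpoly_dvd_charpoly M.charpoly_monic.ne_zero).trans_eq
    M.charpoly_natDegree_eq_dim

/-- The additive Jordan decomposition of a matrix whose size is less than the characteristic. -/
theorem Matrix.exists_isNilpotent_separable_minpoly {F ι : Type*} [Field F] [Fintype ι]
    [DecidableEq ι] (p : ℕ) [CharP F p] (hι : Fintype.card ι < p) (A : Matrix ι ι F) :
    ∃ s N : Matrix ι ι F, A = s + N ∧ Commute s N ∧ IsNilpotent N ∧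
      (minpoly F s).Separable := by
  obtain ⟨g, k, sqf, hdvd, hpow⟩ :=
    exists_squarefree_dvd_pow_of_ne_zero (minpoly.ne_zero_of_finite F (toLin' A))
  have hg : g.natDegree < p := by
    refine (Polynomial.natDegree_le_of_dvd hdvd (minpoly.ne_zero_of_finite F _)).trans_lt ?_
    rw [minpoly_toLin']
    exact A.natDegree_minpoly_le.trans_lt hι
  obtain ⟨N, hN, s, hs, hnil, hss, hA⟩ :=
    Module.End.exists_isNilpotent_isSemisimple_of_separable_of_dvd_pow
      (sqf.separable_of_natDegree_lt_char p hg) hpow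
  have hsN : Commute s N := by
    refine Algebra.commute_of_mem_adjoin_singleton_of_commute hN ?_
    exact (Algebra.commute_of_mem_adjoin_self hs).symm
  let e : Module.End F (ι → F) ≃ₐ[F] Matrix ι ι F := LinearMap.toMatrixAlgEquiv'
  refine ⟨e s, e N, ?_, hsN.map e, hnil.map e, ?_⟩
  · rw [← map_add, add_comm, ← hA]
    exact (LinearMap.toMatrix'_toLin' A).symm
  · have hmin : minpoly F (e s) = minpoly F s := minpoly.algEquiv_eq e s
    refine Squarefree.separable_of_natDegree_lt_char p ?_
      ((e s).natDegree_minpoly_le.trans_lt hι)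
    exact hmin ▸ hss.minpoly_squarefree

theorem Matrix.iSup_eigenspace_map_eq_top_of_separable_minpoly {F K ι : Type*} [Field F]
    [Field K] [IsAlgClosed K] [Algebra F K] [Fintype ι] [DecidableEq ι] {s : Matrix ι ι F}
    (hs : (minpoly F s).Separable) :
    ⨆ μ : K, Module.End.eigenspace ((s.map (algebraMap F K)).mulVecLin) μ = ⊤ := by
  refine Module.End.IsSemisimple.iSup_eigenspace_eq_top ?_
  refine Module.End.isSemisimple_of_squarefree_aeval_eq_zero
    (hs.map (f := algebraMap F K)).squarefree ?_
  let φ : Matrix ι ι F →ₐ[F] Matrix ι ι K := (Algebra.ofId F K).mapMatrix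
  have h : Polynomial.aeval (φ s) (minpoly F s) = 0 := by
    rw [Polynomial.aeval_algHom_apply, minpoly.aeval, map_zero]
  rw [← Polynomial.aeval_map_algebraMap K] at h
  have hEnd := congr_arg (toLinAlgEquiv' : Matrix ι ι K ≃ₐ[K] _) h
  rwa [← Polynomial.aeval_algHom_apply, map_zero] at hEnd

/-- Let `F` be a field of characteristic `p > 0` and `n` a positive integer with `n < p`.
Then every invertible `n × n` matrix over `F` has a multiplicative Jordan decomposition
over `F`: `A = s * u = u * s` with `u` unipotent (`u - 1` nilpotent) and `s` diagonalizable
(semisimple) over an algebraic closure `F̄`. -/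
theorem stmt13 (F : Type*) [Field F] (p : ℕ) (hp : 0 < p) [CharP F p]
    (n : ℕ) (hn : 0 < n) (hnp : n < p)
    (A : Matrix (Fin n) (Fin n) F) (hA : IsUnit A) :
    ∃ s u : Matrix (Fin n) (Fin n) F,
      A = s * u ∧ A = u * s ∧ IsNilpotent (u - 1) ∧
      ⨆ μ : AlgebraicClosure F,
        Module.End.eigenspace ((s.map (algebraMap F (AlgebraicClosure F))).mulVecLin) μ = ⊤ := by
  obtain ⟨s, N, rfl, hcomm, hnil, hsep⟩ :=
    A.exists_isNilpotent_separable_minpoly p (by rwa [Fintype.card_fin])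
  have hs : IsUnit s := by
    simpa using hnil.neg.isUnit_add_left_of_commute hA
      (hcomm.symm.add_right (Commute.refl N)).neg_left
  obtain ⟨v, rfl⟩ := hs
  have hv : Commute (↑v⁻¹ : Matrix (Fin n) (Fin n) F) N := hcomm.units_inv_left
  refine ⟨v, 1 + (↑v⁻¹ : Matrix (Fin n) (Fin n) F) * N, ?_, ?_, ?_,
    Matrix.iSup_eigenspace_map_eq_top_of_separable_minpoly hsep⟩
  · rw [mul_add, mul_one, Units.mul_inv_cancel_left]
  · rw [add_mul, one_mul, hv.eq, Units.inv_mul_cancel_right]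
  · rw [add_sub_cancel_left]
    exact hv.isNilpotent_mul_left hnil
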